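/- arXiv:2004.02159 — 2 statements merged into one kernel-verified Lean document; each statement's English description precedes it below -/
import Mathlib

section
/- Let G be a finite simple graph whose vertex set is partitioned as V(G) = X ⊔ Y such that every vertex of Y has exactly 3 neighbors in X. If the graph polynomial P_{G[X]} has a monomial with nonzero coefficient in which every variable has degree at most 4, and P_{G[Y]} has a monomial with nonzero coefficient in which every variable has degree at most 2, then P_G has a monomial with nonzero coefficient in which every variable has degree at most 5; consequently AT(G) ≤ 6. (This is the algebraic content of the paper's theorem that AT(G_{vf}) ≤ 6 for every plane triangulation G, with X the vertex set, where the plane graph has Alon–Tarsi number at most 5, Y the face set carrying the cubic dual graph, whose Alon–Tarsi number is at most 3, and each face incident to exactly 3 vertices.) -/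
open MvPolynomial Finset

/-- The graph polynomial of `G`: the product, over edges `v_i v_j` of `G` with
`v_i < v_j`, of the factors `(X_i - X_j)`. -/
noncomputable def graphPoly {V : Type*} [Fintype V] [LinearOrder V]
    (G : SimpleGraph V) [DecidableRel G.Adj] : MvPolynomial V ℝ :=
  ∏ p ∈ univ.filter (fun p : V × V => G.Adj p.1 p.2 ∧ p.1 < p.2),
    (X p.1 - X p.2)

/-- The graph polynomial of the induced subgraph `G[s]`, taken in the
corresponding subset of variables (with the inherited vertex ordering). -/
noncomputable def graphPolyOn {V : Type*} [Fintype V] [LinearOrder V]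
    (G : SimpleGraph V) [DecidableRel G.Adj] (s : Finset V) : MvPolynomial V ℝ :=
  ∏ p ∈ univ.filter (fun p : V × V => G.Adj p.1 p.2 ∧ p.1 < p.2 ∧ p.1 ∈ s ∧ p.2 ∈ s),
    (X p.1 - X p.2)

/-- The Alon–Tarsi number of `G`: the least `k` such that `P_G` has a monomial with
nonzero coefficient in which every variable has degree at most `k - 1`. -/
noncomputable def ATNumber {V : Type*} [Fintype V] [LinearOrder V]
    (G : SimpleGraph V) [DecidableRel G.Adj] : ℕ :=
  sInf {k : ℕ | ∃ m : V →₀ ℕ, MvPolynomial.coeff m (graphPoly G) ≠ 0 ∧ ∀ v, m v < k}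

theorem MvPolynomial.apply_eq_zero_of_mem_supported {σ R : Type*} [CommRing R] {s : Set σ}
    {p : MvPolynomial σ R} (hp : p ∈ supported R s) {m : σ →₀ ℕ} (hm : coeff m p ≠ 0)
    {v : σ} (hv : v ∉ s) : m v = 0 := by
  by_contra h
  exact hv (mem_supported.1 hp ((mem_vars_iff_mem_support v).2
    ⟨m, mem_support_iff.2 hm, Finsupp.mem_support_iff.2 h⟩))

/-- For polynomials in disjoint sets of variables, coefficients multiply. -/
theorem MvPolynomial.coeff_add_mul_of_mem_supported {σ R : Type*} [CommRing R] {s t : Set σ}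
    (hst : Disjoint s t) {p q : MvPolynomial σ R} (hp : p ∈ supported R s)
    (hq : q ∈ supported R t) {m n : σ →₀ ℕ} (hm : coeff m p ≠ 0) (hn : coeff n q ≠ 0) :
    coeff (m + n) (p * q) = coeff m p * coeff n q := by
  classical
  rw [coeff_mul]
  refine Finset.sum_eq_single (m, n) ?_ (fun h => (h (by simp)).elim)
  rintro ⟨a, b⟩ hab hne
  by_contra h
  have ha : coeff a p ≠ 0 := left_ne_zero_of_mul h
  have hb : coeff b q ≠ 0 := right_ne_zero_of_mul h
  have hab' : a + b = m + n := mem_antidiagonal.1 hab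
  have ham : a = m := by
    ext v
    by_cases hv : v ∈ s
    · have hvt : v ∉ t := Set.disjoint_left.1 hst hv
      have := DFunLike.congr_fun hab' v
      simpa [apply_eq_zero_of_mem_supported hq hb hvt,
        apply_eq_zero_of_mem_supported hq hn hvt] using this
    · rw [apply_eq_zero_of_mem_supported hp ha hv, apply_eq_zero_of_mem_supported hp hm hv]
  subst ham
  exact hne (by rw [add_left_cancel hab'])

theorem graphPolyOn_mem_supported {V : Type*} [Fintype V] [LinearOrder V]
    (G : SimpleGraph V) [DecidableRel G.Adj] (s : Finset V) :
    graphPolyOn G s ∈ supported ℝ (s : Set V) := by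
  refine Subalgebra.prod_mem _ fun p hp => ?_
  obtain ⟨-, -, -, h1, h2⟩ := Finset.mem_filter.1 hp
  exact Subalgebra.sub_mem _ (X_mem_supported.2 h1) (X_mem_supported.2 h2)

theorem exists_isHomogeneous_graphPolyOn {V : Type*} [Fintype V] [LinearOrder V]
    (G : SimpleGraph V) [DecidableRel G.Adj] (s : Finset V) :
    ∃ d, (graphPolyOn G s).IsHomogeneous d :=
  ⟨_, IsHomogeneous.prod _ _ (fun _ => 1) fun _ _ =>
    (isHomogeneous_X _ _).sub (isHomogeneous_X _ _)⟩

/-- The monomial `m` occurs in `F` and has the largest total degree in the variables from `s`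
among all monomials of `F`. -/
def HasMaxMonomial {σ R : Type*} [CommRing R] (s : Finset σ) (F : MvPolynomial σ R)
    (m : σ →₀ ℕ) : Prop :=
  coeff m F ≠ 0 ∧ ∀ n, coeff n F ≠ 0 → ∑ v ∈ s, n v ≤ ∑ v ∈ s, m v

theorem HasMaxMonomial.neg {σ R : Type*} [CommRing R] {s : Finset σ} {F : MvPolynomial σ R}
    {m : σ →₀ ℕ} (h : HasMaxMonomial s F m) : HasMaxMonomial s (-F) m := by
  simpa [HasMaxMonomial] using h

theorem HasMaxMonomial.mul_X_sub_X {σ R : Type*} [CommRing R] {s : Finset σ}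
    {F : MvPolynomial σ R} {m : σ →₀ ℕ} (h : HasMaxMonomial s F m) {a b : σ}
    (hb : b ∈ s) (ha : a ∉ s) :
    HasMaxMonomial s (F * (X b - X a)) (m + Finsupp.single b 1) := by
  classical
  have sum_b : ∀ n : σ →₀ ℕ, ∑ v ∈ s, (n + Finsupp.single b 1 : σ →₀ ℕ) v = ∑ v ∈ s, n v + 1 := by
    intro n
    simp [Finset.sum_add_distrib, Finsupp.single_apply, hb]
  have sum_a : ∀ n : σ →₀ ℕ, ∑ v ∈ s, (n + Finsupp.single a 1 : σ →₀ ℕ) v = ∑ v ∈ s, n v := by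
    intro n
    simp [Finset.sum_add_distrib, Finsupp.single_apply, ha]
  have key : ∀ (c : σ) (n : σ →₀ ℕ), coeff n (F * X c) ≠ 0 →
      ∃ n', coeff n' F ≠ 0 ∧ n = n' + Finsupp.single c 1 := by
    intro c n hn
    rw [coeff_mul_X'] at hn
    split_ifs at hn with hc
    · refine ⟨_, hn, (tsub_add_cancel_of_le ?_).symm⟩
      rw [Finsupp.single_le_iff]
      exact Nat.one_le_iff_ne_zero.2 (Finsupp.mem_support_iff.1 hc)
    · exact absurd rfl hn
  constructor
  · have h0 : coeff (m + Finsupp.single b 1) (F * X a) = 0 := by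
      by_contra hne
      obtain ⟨n', hn', he⟩ := key a _ hne
      have h1 := h.2 n' hn'
      have h2 := sum_b m
      rw [he, sum_a] at h2
      omega
    rw [mul_sub, coeff_sub, h0, sub_zero, coeff_mul_X]
    exact h.1
  · intro n hn
    rw [sum_b]
    rw [mul_sub, coeff_sub] at hn
    by_cases hnb : coeff n (F * X b) = 0
    · rw [hnb, zero_sub, neg_ne_zero] at hn
      obtain ⟨n', hn', rfl⟩ := key a _ hn
      rw [sum_a]
      exact (h.2 n' hn').trans (Nat.le_succ _)
    · obtain ⟨n', hn', rfl⟩ := key b _ hnb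
      rw [sum_b]
      exact Nat.succ_le_succ (h.2 n' hn')

theorem HasMaxMonomial.mul_prod {σ R : Type*} [CommRing R] [DecidableEq σ] {s : Finset σ}
    {F : MvPolynomial σ R} {m : σ →₀ ℕ} (h : HasMaxMonomial s F m) (T : Finset (σ × σ))
    (hT : ∀ p ∈ T, (p.1 ∈ s ∧ p.2 ∉ s) ∨ (p.1 ∉ s ∧ p.2 ∈ s)) :
    HasMaxMonomial s (F * ∏ p ∈ T, (X p.1 - X p.2))
      (m + ∑ p ∈ T, Finsupp.single (if p.1 ∈ s then p.1 else p.2) 1) := by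
  induction T using Finset.induction_on with
  | empty => simpa using h
  | insert p T hp ih =>
    have ih := ih fun q hq => hT q (Finset.mem_insert_of_mem hq)
    rw [Finset.prod_insert hp, Finset.sum_insert hp, add_comm (Finsupp.single _ _), ← add_assoc,
      mul_comm (X p.1 - X p.2), ← mul_assoc]
    rcases hT p (Finset.mem_insert_self p T) with ⟨h1, h2⟩ | ⟨h1, h2⟩
    · rw [if_pos h1]
      exact ih.mul_X_sub_X h1 h2
    · rw [if_neg h1, ← neg_sub (X p.2), mul_neg]
      exact (ih.mul_X_sub_X h2 h1).neg

theorem hasMaxMonomial_graphPolyOn_mul {V : Type*} [Fintype V] [LinearOrder V]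
    (G : SimpleGraph V) [DecidableRel G.Adj] {A B : Finset V} (hdisj : Disjoint A B)
    {m n : V →₀ ℕ} (hm : coeff m (graphPolyOn G A) ≠ 0) (hn : coeff n (graphPolyOn G B) ≠ 0) :
    HasMaxMonomial B (graphPolyOn G A * graphPolyOn G B) (m + n) := by
  classical
  have hA := graphPolyOn_mem_supported G A
  have hB := graphPolyOn_mem_supported G B
  obtain ⟨d, hd⟩ := exists_isHomogeneous_graphPolyOn G B
  have sum_B : ∀ a b : V →₀ ℕ, coeff a (graphPolyOn G A) ≠ 0 → coeff b (graphPolyOn G B) ≠ 0 →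
      ∑ v ∈ B, (a + b) v = d := by
    intro a b ha hb
    have hdeg : b.degree = d := by
      rw [Finsupp.degree_eq_weight_one]
      exact hd hb
    rw [← hdeg, Finsupp.degree_eq_sum, ← Finset.sum_subset (Finset.subset_univ B)
      fun v _ hv => apply_eq_zero_of_mem_supported hB hb hv]
    refine Finset.sum_congr rfl fun v hv => ?_
    have hvA : v ∉ A := Finset.disjoint_right.1 hdisj hv
    simp [apply_eq_zero_of_mem_supported hA ha hvA]
  constructor
  · rw [coeff_add_mul_of_mem_supported (Finset.disjoint_coe.2 hdisj) hA hB hm hn]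
    exact mul_ne_zero hm hn
  · intro k hk
    rw [coeff_mul] at hk
    obtain ⟨⟨a, b⟩, hab, hne⟩ := Finset.exists_ne_zero_of_sum_ne_zero hk
    rw [← mem_antidiagonal.1 hab, sum_B m n hm hn,
      sum_B a b (left_ne_zero_of_mul hne) (right_ne_zero_of_mul hne)]

theorem graphPoly_eq_mul_prod_cross {V : Type*} [Fintype V] [LinearOrder V]
    (G : SimpleGraph V) [DecidableRel G.Adj] {A B : Finset V} (hcover : A ∪ B = univ)
    (hdisj : Disjoint A B) :
    graphPoly G = graphPolyOn G A * graphPolyOn G B *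
      ∏ p ∈ univ.filter (fun p : V × V => G.Adj p.1 p.2 ∧ p.1 < p.2 ∧ (p.1 ∈ B ↔ p.2 ∉ B)),
        (X p.1 - X p.2) := by
  have hAB : ∀ v, v ∈ A ↔ v ∉ B := fun v =>
    ⟨fun h => Finset.disjoint_left.1 hdisj h, fun h =>
      (Finset.mem_union.1 (hcover ▸ Finset.mem_univ v)).resolve_right h⟩
  unfold graphPoly graphPolyOn
  rw [← Finset.prod_union, ← Finset.prod_union]
  · refine Finset.prod_congr ?_ fun _ _ => rfl
    ext p
    simp only [Finset.mem_union, Finset.mem_filter, Finset.mem_univ, true_and, hAB]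
    tauto
  all_goals
    rw [Finset.disjoint_left]
    intro p
    simp only [Finset.mem_union, Finset.mem_filter, Finset.mem_univ, true_and, hAB]
    tauto

/-- Algebraic content of \`AT(G_{vf}) ≤ 6\` for plane triangulations: if \`V(G) = A ⊔ B\` with every vertex of \`B\` having exactly 3 neighbors in \`A\`, \`P_{G[A]}\` has a non-vanishing monomial with all degrees at most 4, and \`P_{G[B]}\` has a non-vanishing monomial with all degrees at most 2, then \`P_G\` has a non-vanishing monomial with all degrees at most 5; consequently \`AT(G) ≤ 6\`. -/
theorem atNumber_le_six_vertexface {V : Type*} [Fintype V] [LinearOrder V]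
    (G : SimpleGraph V) [DecidableRel G.Adj]
    (A B : Finset V) (hcover : A ∪ B = univ) (hdisj : Disjoint A B)
    (ht : ∀ y ∈ B, (A.filter (fun x => G.Adj y x)).card = 3)
    (hA : ∃ m : V →₀ ℕ, MvPolynomial.coeff m (graphPolyOn G A) ≠ 0 ∧ ∀ v, m v ≤ 4)
    (hB : ∃ m : V →₀ ℕ, MvPolynomial.coeff m (graphPolyOn G B) ≠ 0 ∧ ∀ v, m v ≤ 2) :
    (∃ m : V →₀ ℕ, MvPolynomial.coeff m (graphPoly G) ≠ 0 ∧ ∀ v, m v ≤ 5) ∧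
    ATNumber G ≤ 6 := by
  have main : ∃ m : V →₀ ℕ, MvPolynomial.coeff m (graphPoly G) ≠ 0 ∧ ∀ v, m v ≤ 5 := by
    obtain ⟨m, hm, hm4⟩ := hA
    obtain ⟨n, hn, hn2⟩ := hB
    have hmax := (hasMaxMonomial_graphPolyOn_mul G hdisj hm hn).mul_prod
      (univ.filter (fun p : V × V => G.Adj p.1 p.2 ∧ p.1 < p.2 ∧ (p.1 ∈ B ↔ p.2 ∉ B)))
      (by
        intro p hp
        have := (Finset.mem_filter.1 hp).2
        tauto)
    rw [← graphPoly_eq_mul_prod_cross G hcover hdisj] at hmax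
    refine ⟨_, hmax.1, fun v => ?_⟩
    rw [Finsupp.add_apply, Finsupp.add_apply, Finsupp.finsetSum_apply]
    simp only [Finsupp.single_apply]
    rw [← Finset.card_filter]
    by_cases hv : v ∈ B
    · have hm0 : m v = 0 := apply_eq_zero_of_mem_supported (graphPolyOn_mem_supported G A) hm
        (Finset.disjoint_right.1 hdisj hv)
      have hmemA : ∀ x, x ∉ B → x ∈ A := fun x hx =>
        (Finset.mem_union.1 (hcover ▸ Finset.mem_univ x)).resolve_right hx
      refine (add_le_add (add_le_add hm0.le (hn2 v)) ((Finset.card_le_card_of_injOn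
        (fun p : V × V => if p.1 ∈ B then p.2 else p.1) ?_ ?_).trans (ht v hv).le))
      · rintro ⟨x, y⟩ hp
        simp only [Finset.coe_filter, Finset.mem_filter, Finset.mem_univ, true_and,
          Set.mem_ofPred_eq] at hp ⊢
        obtain ⟨⟨hadj, -, hc⟩, he⟩ := hp
        split_ifs at he ⊢ with hx
        · exact ⟨hmemA y (hc.1 hx), he ▸ hadj⟩
        · exact ⟨hmemA x hx, he ▸ hadj.symm⟩
      · rintro ⟨x, y⟩ hp ⟨x', y'⟩ hp' heq
        simp only [Finset.coe_filter, Finset.mem_filter, Finset.mem_univ, true_and,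
          Set.mem_ofPred_eq] at hp hp' heq
        obtain ⟨⟨-, hlt, -⟩, he⟩ := hp
        obtain ⟨⟨-, hlt', -⟩, he'⟩ := hp'
        rw [Prod.mk.injEq]
        split_ifs at he he' heq <;> subst_vars
        · exact ⟨rfl, rfl⟩
        · exact absurd hlt hlt'.asymm
        · exact absurd hlt hlt'.asymm
        · exact ⟨rfl, rfl⟩
    · have hn0 : n v = 0 :=
        apply_eq_zero_of_mem_supported (graphPolyOn_mem_supported G B) hn hv
      rw [hn0, Finset.card_eq_zero.2]
      · exact (hm4 v).trans (by norm_num)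
      · refine Finset.filter_eq_empty_iff.2 ?_
        rintro ⟨x, y⟩ hp he
        have hc := (Finset.mem_filter.1 hp).2.2.2
        dsimp only at he hc
        split_ifs at he with hx
        · exact hv (he ▸ hx)
        · exact hv (he ▸ not_not.1 fun hy => hx (hc.2 hy))
  refine ⟨main, ?_⟩
  obtain ⟨m, hm, hm5⟩ := main
  exact Nat.sInf_le ⟨m, hm, fun v => Nat.lt_succ_of_le (hm5 v)⟩
end

section
/- Let G be a finite simple graph on vertices v₁,…,vₙ. If the graph polynomial P_G contains a monomial with nonzero coefficient of multidegree (α₁,…,αₙ) (i.e., degree α_i in the variable of v_i), then G is p-paintable for the function p defined by p(v_i) = α_i + 1. In particular, the painting number satisfies 𝜒_P(G) ≤ AT(G), where 𝜒_P(G) is the least k such that G is p-paintable for the constant function p ≡ k. -/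
open MvPolynomial Finset

/-- Paintability of the subgraph of `G` induced on the finite set `s` of (remaining)
vertices, with respect to `p` giving the number of colors still available at each
vertex: either there are no vertices, or `p v > 0` for every vertex `v` and for every
nonempty set `X` of vertices there is an independent subset `X' ⊆ X` such that
`G - X'` is `q`-paintable, where `q v = p v - 1` for `v ∈ X \ X'` and `q v = p v`
otherwise. -/
def Paintable {V : Type*} [DecidableEq V] (G : SimpleGraph V)
    (s : Finset V) (p : V → ℕ) : Prop :=
  s = ∅ ∨ ∃ _hpos : ∀ v ∈ s, 0 < p v,
    ∀ X : Finset V, ∀ _hX : X ⊆ s, ∀ _hne : X.Nonempty,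
      ∃ X' ⊆ X, (∀ u ∈ X', ∀ v ∈ X', ¬ G.Adj u v) ∧
        Paintable G (s \ X') (fun v => if v ∈ X \ X' then p v - 1 else p v)
termination_by s.card + ∑ v ∈ s, p v
decreasing_by
  simp only [dite_eq_ite]
  by_cases hXs : (s ∩ X').Nonempty
  · obtain ⟨v₀, hv₀⟩ := hXs
    rw [Finset.mem_inter] at hv₀
    have h1 : (s \ X').card < s.card := by
      apply Finset.card_lt_card
      refine ⟨Finset.sdiff_subset, fun hsub => ?_⟩
      have := hsub hv₀.1
      simp [hv₀.2] at this
    have h2 : ∑ v ∈ s \ X', (if v ∈ X \ X' then p v - 1 else p v) ≤ ∑ v ∈ s, p v :=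
      calc ∑ v ∈ s \ X', (if v ∈ X \ X' then p v - 1 else p v)
          ≤ ∑ v ∈ s \ X', p v := Finset.sum_le_sum (fun v _ => by split <;> omega)
        _ ≤ ∑ v ∈ s, p v := Finset.sum_le_sum_of_subset Finset.sdiff_subset
    omega
  · have hs : s \ X' = s := by
      ext v
      simp only [Finset.mem_sdiff, and_iff_left_iff_imp]
      intro hv
      exact fun hv' => hXs ⟨v, Finset.mem_inter.mpr ⟨hv, hv'⟩⟩
    obtain ⟨v₀, hv₀X⟩ := _hne
    have hv₀s : v₀ ∈ s := _hX hv₀X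
    have hv₀X' : v₀ ∉ X' := fun h => hXs ⟨v₀, Finset.mem_inter.mpr ⟨hv₀s, h⟩⟩
    have h2 : ∑ v ∈ s \ X', (if v ∈ X \ X' then p v - 1 else p v) < ∑ v ∈ s, p v := by
      rw [hs]
      apply Finset.sum_lt_sum (fun v _ => by split <;> omega)
      exact ⟨v₀, hv₀s, by
        rw [if_pos (Finset.mem_sdiff.mpr ⟨hv₀X, hv₀X'⟩)]
        have := _hpos v₀ hv₀s
        omega⟩
    rw [hs] at h2 ⊢
    omega

/-- The linear functional on polynomials sending the monomial `x ^ m` to `w m`. -/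
noncomputable def monomialFunctional {σ : Type*} (w : (σ →₀ ℕ) → ℝ) :
    MvPolynomial σ ℝ →ₗ[ℝ] ℝ :=
  (basisMonomials σ ℝ).constr ℝ w

theorem monomialFunctional_monomial {σ : Type*} (w : (σ →₀ ℕ) → ℝ) (m : σ →₀ ℕ) (c : ℝ) :
    monomialFunctional w (monomial m c) = c * w m := by
  have h : monomial m c = c • (basisMonomials σ ℝ) m := by
    simp [coe_basisMonomials, smul_monomial]
  rw [h, map_smul, monomialFunctional, Module.Basis.constr_basis, smul_eq_mul]

theorem monomialFunctional_apply {σ : Type*} (w : (σ →₀ ℕ) → ℝ) (f : MvPolynomial σ ℝ) :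
    monomialFunctional w f = ∑ m ∈ f.support, coeff m f * w m := by
  conv_lhs => rw [f.as_sum, map_sum]
  simp only [monomialFunctional_monomial]

/-- The substitution setting the variables in `Y` to `1`. -/
noncomputable def setOne {σ : Type*} [DecidableEq σ] (Y : Finset σ) :
    MvPolynomial σ ℝ →ₐ[ℝ] MvPolynomial σ ℝ :=
  aeval fun v => if v ∈ Y then 1 else X v

theorem setOne_X {σ : Type*} [DecidableEq σ] (Y : Finset σ) (v : σ) :
    setOne Y (X v) = if v ∈ Y then 1 else X v := by
  simp [setOne]

theorem setOne_monomial {σ : Type*} [DecidableEq σ] (Y : Finset σ) (m : σ →₀ ℕ) (c : ℝ) :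
    setOne Y (monomial m c) = monomial (m.filter (· ∉ Y)) c := by
  rw [setOne, aeval_monomial, monomial_eq, algebraMap_eq]
  congr 1
  rw [Finsupp.prod_filter_index, Finsupp.prod, Finsupp.support_filter, Finset.prod_filter]
  refine Finset.prod_congr rfl fun v _ => ?_
  by_cases hv : v ∈ Y <;> simp [hv]

/-- A functional whose weights ignore the exponents in `Y` is unchanged by setting the variables
in `Y` to `1`. -/
theorem monomialFunctional_setOne {σ : Type*} [DecidableEq σ] (Y : Finset σ)
    (w : (σ →₀ ℕ) → ℝ) (hw : ∀ m, w (m.filter (· ∉ Y)) = w m) (f : MvPolynomial σ ℝ) :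
    monomialFunctional w (setOne Y f) = monomialFunctional w f := by
  conv_lhs => rw [f.as_sum, map_sum, map_sum]
  simp only [setOne_monomial, monomialFunctional_monomial, hw]
  rw [monomialFunctional_apply]

/-- If `f` is homogeneous and contains `x ^ α`, then for every set `Y` of variables there is a
subset `Z` such that setting the variables in `Z` to `1` leaves a monomial whose exponents drop
strictly below `α` on `Y \ Z` and agree with `α` off `Y`. -/
theorem exists_coeff_setOne_ne_zero {σ : Type*} [Fintype σ] [DecidableEq σ]
    {f : MvPolynomial σ ℝ} {n : ℕ} (hf : f.IsHomogeneous n) {α : σ →₀ ℕ}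
    (hα : coeff α f ≠ 0) (Y : Finset σ) :
    ∃ Z ⊆ Y, ∃ m, coeff m (setOne Z f) ≠ 0 ∧ (∀ v ∈ Y \ Z, m v < α v) ∧
      ∀ v ∉ Y, m v = α v := by
  let g : (σ →₀ ℕ) → σ → ℝ := fun m v => if m v < α v then -1 else 0
  let w₀ : (σ →₀ ℕ) → ℝ := fun m => if ∀ v ∉ Y, m v = α v then 1 else 0
  let w : Finset σ → (σ →₀ ℕ) → ℝ := fun Z m => w₀ m * ∏ v ∈ Y \ Z, g m v
  have hexp (m : σ →₀ ℕ) : ∑ Z ∈ Y.powerset, w Z m = w₀ m * ∏ v ∈ Y, (1 + g m v) := by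
    simp [w, Finset.prod_add, Finset.mul_sum]
  have hsum : ∑ Z ∈ Y.powerset, monomialFunctional (w Z) f = coeff α f := by
    simp only [monomialFunctional_apply]
    rw [Finset.sum_comm]
    simp only [← Finset.mul_sum, hexp]
    rw [Finset.sum_eq_single_of_mem α (mem_support_iff.2 hα)]
    · simp [w₀, g]
    · intro m hm hne
      refine mul_eq_zero_of_right _ ?_
      by_contra hnz
      obtain ⟨h₀, h₁⟩ := mul_ne_zero_iff.1 hnz
      have hoff : ∀ v ∉ Y, m v = α v := by
        by_contra h
        exact h₀ (if_neg h)
      have hle (v : σ) : α v ≤ m v := by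
        by_cases hv : v ∈ Y
        · by_contra hlt
          exact Finset.prod_ne_zero_iff.1 h₁ v hv (by simp [g, not_le.1 hlt])
        · exact (hoff v hv).ge
      have hdeg : ∑ v, α v = ∑ v, m v := by
        rw [← Finsupp.degree_eq_sum, ← Finsupp.degree_eq_sum, Finsupp.degree_eq_weight_one]
        exact (hf hα).trans (hf (mem_support_iff.1 hm)).symm
      exact hne (Finsupp.ext fun v =>
        ((Finset.sum_eq_sum_iff_of_le fun v _ => hle v).1 hdeg v (mem_univ v)).symm)
  obtain ⟨Z, hZ, hne⟩ := Finset.exists_ne_zero_of_sum_ne_zero (hsum ▸ hα)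
  rw [Finset.mem_powerset] at hZ
  have hinv (m : σ →₀ ℕ) : w Z (m.filter (· ∉ Z)) = w Z m := by
    have hfilter (v : σ) (hv : v ∉ Z) : m.filter (· ∉ Z) v = m v :=
      Finsupp.filter_apply_pos _ _ hv
    have hg : ∏ v ∈ Y \ Z, g (m.filter (· ∉ Z)) v = ∏ v ∈ Y \ Z, g m v :=
      Finset.prod_congr rfl fun v hv => by
        simp only [g, hfilter v (Finset.mem_sdiff.1 hv).2]
    have hw₀ : w₀ (m.filter (· ∉ Z)) = w₀ m := by
      have : (∀ v ∉ Y, m.filter (· ∉ Z) v = α v) ↔ ∀ v ∉ Y, m v = α v :=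
        forall₂_congr fun v hv => by rw [hfilter v fun h => hv (hZ h)]
      simp only [w₀, this]
    simp only [w, hg, hw₀]
  rw [← monomialFunctional_setOne Z _ hinv, monomialFunctional_apply] at hne
  obtain ⟨m, -, hm⟩ := Finset.exists_ne_zero_of_sum_ne_zero hne
  obtain ⟨hc, hwm⟩ := mul_ne_zero_iff.1 hm
  obtain ⟨h₀, h₁⟩ := mul_ne_zero_iff.1 hwm
  refine ⟨Z, hZ, m, hc, fun v hv => ?_, ?_⟩
  · by_contra hlt
    exact Finset.prod_ne_zero_iff.1 h₁ v hv (if_neg hlt)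
  · by_contra h
    exact h₀ (if_neg h)

section GraphPoly

variable {V : Type*} [Fintype V] [LinearOrder V] (G : SimpleGraph V) [DecidableRel G.Adj]

theorem graphPolyOn_univ : graphPolyOn G univ = graphPoly G := by
  simp [graphPolyOn, graphPoly]

theorem graphPolyOn_isHomogeneous (s : Finset V) :
    ∃ n, (graphPolyOn G s).IsHomogeneous n :=
  ⟨_, IsHomogeneous.prod _ _ (fun _ => 1) fun p _ =>
    (isHomogeneous_X ℝ p.1).sub (isHomogeneous_X ℝ p.2)⟩

theorem graphPolyOn_sdiff_dvd_setOne (s Z : Finset V) :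
    graphPolyOn G (s \ Z) ∣ setOne Z (graphPolyOn G s) := by
  rw [graphPolyOn, graphPolyOn, map_prod]
  calc _ = ∏ p ∈ univ.filter (fun p : V × V =>
            G.Adj p.1 p.2 ∧ p.1 < p.2 ∧ p.1 ∈ s \ Z ∧ p.2 ∈ s \ Z),
          setOne Z (X p.1 - X p.2) := by
        refine Finset.prod_congr rfl fun p hp => ?_
        simp only [Finset.mem_filter, Finset.mem_sdiff] at hp
        simp [setOne_X, hp]
    _ ∣ _ := by
        refine Finset.prod_dvd_prod_of_subset _ _ _ fun p hp => ?_
        simp only [Finset.mem_filter, Finset.mem_sdiff] at hp ⊢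
        tauto

theorem not_adj_of_setOne_graphPolyOn_ne_zero {s Z : Finset V} (hZ : Z ⊆ s)
    (h : setOne Z (graphPolyOn G s) ≠ 0) : ∀ u ∈ Z, ∀ v ∈ Z, ¬ G.Adj u v := by
  have key (u v : V) (hu : u ∈ Z) (hv : v ∈ Z) (hadj : G.Adj u v) : ¬ u < v := by
    intro hlt
    rw [graphPolyOn, map_prod, Finset.prod_ne_zero_iff] at h
    exact h (u, v) (by simp [hadj, hlt, hZ hu, hZ hv]) (by simp [setOne_X, hu, hv])
  intro u hu v hv hadj
  rcases lt_trichotomy u v with hlt | rfl | hlt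
  · exact key u v hu hv hadj hlt
  · exact G.loopless.irrefl u hadj
  · exact key v u hv hu hadj.symm hlt

/-- One round of painting: if `P_{G[s]}` contains `x ^ α`, then any `Y ⊆ s` has an independent
subset `Z` such that `P_{G[s \ Z]}` contains a monomial with exponents at most `α` off `Y` and
strictly below `α` on `Y \ Z`. -/
theorem exists_independent_coeff_graphPolyOn_ne_zero {s : Finset V} {α : V →₀ ℕ}
    (hα : coeff α (graphPolyOn G s) ≠ 0) {Y : Finset V} (hY : Y ⊆ s) :
    ∃ Z ⊆ Y, (∀ u ∈ Z, ∀ v ∈ Z, ¬ G.Adj u v) ∧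
      ∃ β, coeff β (graphPolyOn G (s \ Z)) ≠ 0 ∧ (∀ v ∈ Y \ Z, β v < α v) ∧
        ∀ v ∉ Y, β v ≤ α v := by
  obtain ⟨n, hn⟩ := graphPolyOn_isHomogeneous G s
  obtain ⟨Z, hZ, m, hm, hlt, heq⟩ := exists_coeff_setOne_ne_zero hn hα Y
  refine ⟨Z, hZ, not_adj_of_setOne_graphPolyOn_ne_zero G (hZ.trans hY) fun h => hm (by simp [h]),
    ?_⟩
  obtain ⟨q, hq⟩ := graphPolyOn_sdiff_dvd_setOne G s Z
  rw [hq, ← mem_support_iff] at hm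
  obtain ⟨β, hβ, γ, -, rfl⟩ := Finset.mem_add.1 (support_mul _ _ hm)
  refine ⟨β, mem_support_iff.1 hβ, fun v hv => ?_, fun v hv => ?_⟩
  · exact lt_of_le_of_lt (by simp) (hlt v hv)
  · exact le_trans (by simp) (heq v hv).le

theorem paintable_of_coeff_graphPolyOn_ne_zero (s : Finset V) (p : V → ℕ) (α : V →₀ ℕ)
    (hα : coeff α (graphPolyOn G s) ≠ 0) (hp : ∀ v ∈ s, α v < p v) : Paintable G s p := by
  induction hN : ∑ v ∈ s, (p v + 1) using Nat.strong_induction_on generalizing s p α with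
  | _ N ih =>
    subst hN
    have hpos : ∀ v ∈ s, 0 < p v := fun v hv => (Nat.zero_le _).trans_lt (hp v hv)
    rw [Paintable]
    refine Or.inr ⟨hpos, fun Y hY ⟨v₀, hv₀⟩ => ?_⟩
    obtain ⟨Z, hZ, hind, β, hβ, hlt, hle⟩ :=
      exists_independent_coeff_graphPolyOn_ne_zero G hα hY
    refine ⟨Z, hZ, hind, ih _ ?_ _ _ β hβ ?_ rfl⟩
    · rw [← Finset.filter_notMem_eq_sdiff, Finset.sum_filter]
      refine Finset.sum_lt_sum (fun v _ => ?_) ⟨v₀, hY hv₀, ?_⟩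
      · split_ifs <;> omega
      · have := hpos v₀ (hY hv₀)
        by_cases hv : v₀ ∈ Z <;> simp [hv, hv₀]
        omega
    · intro v hv
      obtain ⟨hvs, hvZ⟩ := Finset.mem_sdiff.1 hv
      have := hp v hvs
      split_ifs with h
      · have := hlt v h
        omega
      · have := hle v fun hvY => h (Finset.mem_sdiff.2 ⟨hvY, hvZ⟩)
        omega

end GraphPoly

/-- Schauz's theorem: if the graph polynomial `P_G` contains a non-vanishing monomial
of multidegree `α`, then `G` is `p`-paintable for `p v = α v + 1`.  In particular the
painting number of `G` (the least `k` such that `G` is paintable for the constant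
function `k`) is at most its Alon–Tarsi number. -/
theorem paintable_of_coeff_graphPoly_ne_zero {V : Type*} [Fintype V] [LinearOrder V]
    (G : SimpleGraph V) [DecidableRel G.Adj]
    (α : V →₀ ℕ) (hα : MvPolynomial.coeff α (graphPoly G) ≠ 0) :
    Paintable G univ (fun v => α v + 1) ∧
      sInf {k : ℕ | Paintable G univ (fun _ => k)} ≤ ATNumber G := by
  have key (p : V → ℕ) (m : V →₀ ℕ) (hm : coeff m (graphPoly G) ≠ 0) (hp : ∀ v, m v < p v) :
      Paintable G univ p :=
    paintable_of_coeff_graphPolyOn_ne_zero G univ p m (by rwa [graphPolyOn_univ]) fun v _ => hp v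
  refine ⟨key _ α hα fun v => Nat.lt_succ_self _, Nat.sInf_le ?_⟩
  have hne : {k : ℕ | ∃ m : V →₀ ℕ, coeff m (graphPoly G) ≠ 0 ∧ ∀ v, m v < k}.Nonempty :=
    ⟨univ.sup α + 1, α, hα, fun v => Nat.lt_succ_of_le (Finset.le_sup (mem_univ v))⟩
  obtain ⟨m, hm, hlt⟩ := Nat.sInf_mem hne
  exact key _ m hm hlt
end
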